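/- For every lower semilinear diagonal δ ∈ 𝒟^LSL, Chatterjee's rank correlation satisfies the lower bound 2·τ(δ)² / (1 + τ(δ)) ≤ ξ(δ). -/

import Mathlib

open MeasureTheory Set

/-- A lower semilinear diagonal: nondecreasing, 2-Lipschitz on `[0,1]`, `δ 1 = 1`,
`t² ≤ δ t ≤ t` on `[0,1]`, `t ↦ δ t / t` nondecreasing on `(0,1]` and
`t ↦ δ t / t²` nonincreasing on `(0,1]`. -/
def IsLSL (δ : ℝ → ℝ) : Prop :=
  MonotoneOn δ (Icc 0 1) ∧
  LipschitzOnWith 2 δ (Icc 0 1) ∧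
  δ 1 = 1 ∧
  (∀ t ∈ Icc (0:ℝ) 1, t ^ 2 ≤ δ t ∧ δ t ≤ t) ∧
  MonotoneOn (fun t => δ t / t) (Ioc 0 1) ∧
  AntitoneOn (fun t => δ t / t ^ 2) (Ioc 0 1)

/-- Kendall's tau of the lower semilinear copula with diagonal `δ`. -/
noncomputable def tauLSL (δ : ℝ → ℝ) : ℝ := 4 * (∫ t in (0:ℝ)..1, (δ t) ^ 2 / t) - 1

/-- Spearman's rho of the lower semilinear copula with diagonal `δ`. -/
noncomputable def rhoLSL (δ : ℝ → ℝ) : ℝ := 12 * (∫ t in (0:ℝ)..1, t * δ t) - 3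

/-- Spearman's footrule of the lower semilinear copula with diagonal `δ`. -/
noncomputable def phiLSL (δ : ℝ → ℝ) : ℝ := 6 * (∫ t in (0:ℝ)..1, δ t) - 2

/-- Chatterjee's rank correlation of the lower semilinear copula with diagonal `δ`,
expressed through the a.e. derivative of `δ` (represented by `deriv δ`, which agrees
with the a.e. derivative almost everywhere since `δ` is Lipschitz on `[0,1]`). -/
noncomputable def xiLSL (δ : ℝ → ℝ) : ℝ :=
  tauLSL δ - 2 * ∫ t in (0:ℝ)..1,
    (t * deriv δ t - δ t) * (2 * δ t - t * deriv δ t) / t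

/-- The diagonal `u_a`: `u_a t = t²/a` for `t ≤ a`, `u_a t = t` otherwise (`u_0 t = t`). -/
noncomputable def uDiag (a : ℝ) (t : ℝ) : ℝ :=
  if a = 0 then t else if t ≤ a then t ^ 2 / a else t

/-- The diagonal `l_a`: `l_a t = a·t` for `t ≤ a`, `l_a t = t²` otherwise. -/
noncomputable def lDiag (a : ℝ) (t : ℝ) : ℝ := if t ≤ a then a * t else t ^ 2

theorem intervalIntegrable_of_norm_le_on_Ioo {f : ℝ → ℝ} {a b C : ℝ} (hab : a ≤ b)
    (hf : AEStronglyMeasurable f (volume.restrict (Ioo a b)))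
    (hC : ∀ t ∈ Ioo a b, ‖f t‖ ≤ C) : IntervalIntegrable f volume a b := by
  rw [intervalIntegrable_iff_integrableOn_Ioo_of_le hab]
  refine ⟨hf, .restrict_of_bounded (C := C) measure_Ioo_lt_top ?_⟩
  filter_upwards [ae_restrict_mem measurableSet_Ioo] with t ht using hC t ht

namespace IsLSL

variable {δ : ℝ → ℝ}

theorem apply_zero (hδ : IsLSL δ) : δ 0 = 0 := by
  have h := hδ.2.2.2.1 0 ⟨le_rfl, zero_le_one⟩
  linarith [h.1, h.2]

theorem absolutelyContinuousOnInterval (hδ : IsLSL δ) :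
    AbsolutelyContinuousOnInterval δ 0 1 :=
  LipschitzOnWith.absolutelyContinuousOnInterval (K := 2)
    (by rw [uIcc_of_le zero_le_one]; exact hδ.2.1)

theorem aestronglyMeasurable (hδ : IsLSL δ) :
    AEStronglyMeasurable δ (volume.restrict (Ioo 0 1)) :=
  (hδ.2.1.continuousOn.mono Ioo_subset_Icc_self).aestronglyMeasurable measurableSet_Ioo

theorem norm_deriv_le (hδ : IsLSL δ) {t : ℝ} (ht : t ∈ Ioo (0 : ℝ) 1) :
    ‖deriv δ t‖ ≤ 2 :=
  norm_deriv_le_of_lipschitzOn (Icc_mem_nhds ht.1 ht.2) hδ.2.1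

theorem intervalIntegrable_sq_div (hδ : IsLSL δ) :
    IntervalIntegrable (fun t => δ t ^ 2 / t) volume 0 1 := by
  refine intervalIntegrable_of_norm_le_on_Ioo (C := 1) zero_le_one
    ((hδ.aestronglyMeasurable.pow 2).mul measurable_inv.aestronglyMeasurable) fun t ht => ?_
  obtain ⟨h1, h2⟩ := hδ.2.2.2.1 t (Ioo_subset_Icc_self ht)
  rw [Real.norm_of_nonneg (div_nonneg (sq_nonneg _) ht.1.le), div_le_one ht.1]
  nlinarith [ht.1, ht.2, sq_nonneg t]

theorem intervalIntegrable_mul_deriv (hδ : IsLSL δ) :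
    IntervalIntegrable (fun t => δ t * deriv δ t) volume 0 1 :=
  hδ.absolutelyContinuousOnInterval.intervalIntegrable_deriv.continuousOn_mul
    hδ.absolutelyContinuousOnInterval.continuousOn

theorem intervalIntegrable_mul_deriv_sq (hδ : IsLSL δ) :
    IntervalIntegrable (fun t => t * deriv δ t ^ 2) volume 0 1 := by
  refine intervalIntegrable_of_norm_le_on_Ioo (C := 4) zero_le_one
    (measurable_id.mul ((measurable_deriv δ).pow_const 2)).aestronglyMeasurable fun t ht => ?_
  have h := hδ.norm_deriv_le ht
  rw [norm_mul, norm_pow, Real.norm_of_nonneg ht.1.le]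
  nlinarith [ht.1, ht.2, norm_nonneg (deriv δ t)]

theorem integral_mul_deriv (hδ : IsLSL δ) : ∫ t in (0 : ℝ)..1, δ t * deriv δ t = 1 / 2 := by
  have hac := hδ.absolutelyContinuousOnInterval
  have h := hac.integral_mul_deriv_eq_deriv_mul hac
  simp only [mul_comm (deriv δ _), hδ.apply_zero, hδ.2.2.1] at h
  linarith

theorem integral_sq_div_pos (hδ : IsLSL δ) : 0 < ∫ t in (0 : ℝ)..1, δ t ^ 2 / t := by
  refine intervalIntegral.intervalIntegral_pos_of_pos_on hδ.intervalIntegrable_sq_div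
    (fun t ht => ?_) zero_lt_one
  have h := (hδ.2.2.2.1 t (Ioo_subset_Icc_self ht)).1
  have := pow_pos ht.1 2
  have h0 : 0 < δ t := by linarith
  exact div_pos (pow_pos h0 2) ht.1

/-- Chatterjee's rank correlation, with the integrand expanded and `integral_mul_deriv` applied. -/
theorem xiLSL_eq (hδ : IsLSL δ) :
    xiLSL δ = 2 * tauLSL δ - 2 + 2 * ∫ t in (0 : ℝ)..1, t * deriv δ t ^ 2 := by
  have hexp : ∫ t in (0 : ℝ)..1, (t * deriv δ t - δ t) * (2 * δ t - t * deriv δ t) / t =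
      ∫ t in (0 : ℝ)..1, (3 * (δ t * deriv δ t) - t * deriv δ t ^ 2 - 2 * (δ t ^ 2 / t)) := by
    refine intervalIntegral.integral_congr fun t _ => ?_
    rcases eq_or_ne t 0 with rfl | ht
    · simp [hδ.apply_zero]
    · field_simp
      ring
  rw [xiLSL, hexp, intervalIntegral.integral_sub
      ((hδ.intervalIntegrable_mul_deriv.const_mul 3).sub hδ.intervalIntegrable_mul_deriv_sq)
      (hδ.intervalIntegrable_sq_div.const_mul 2),
    intervalIntegral.integral_sub (hδ.intervalIntegrable_mul_deriv.const_mul 3)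
      hδ.intervalIntegrable_mul_deriv_sq,
    intervalIntegral.integral_const_mul, intervalIntegral.integral_const_mul,
    hδ.integral_mul_deriv, tauLSL]
  ring

/-- The Cauchy-Schwarz inequality for `δ t / √t` and `√t * deriv δ t`, in linearized form. -/
theorem sub_le_integral_mul_deriv_sq (hδ : IsLSL δ) (c : ℝ) :
    c - c ^ 2 * ∫ t in (0 : ℝ)..1, δ t ^ 2 / t ≤ ∫ t in (0 : ℝ)..1, t * deriv δ t ^ 2 := by
  have hle : ∫ t in (0 : ℝ)..1, (2 * c * (δ t * deriv δ t) - c ^ 2 * (δ t ^ 2 / t)) ≤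
      ∫ t in (0 : ℝ)..1, t * deriv δ t ^ 2 := by
    refine intervalIntegral.integral_mono_on_of_le_Ioo zero_le_one
      ((hδ.intervalIntegrable_mul_deriv.const_mul _).sub
        (hδ.intervalIntegrable_sq_div.const_mul _))
      hδ.intervalIntegrable_mul_deriv_sq fun t ht => ?_
    have ht0 := ht.1.ne'
    have h : t * deriv δ t ^ 2 - (2 * c * (δ t * deriv δ t) - c ^ 2 * (δ t ^ 2 / t)) =
        (t * deriv δ t - c * δ t) ^ 2 / t := by
      field_simp
      ring
    have := div_nonneg (sq_nonneg (t * deriv δ t - c * δ t)) ht.1.le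
    linarith
  rw [intervalIntegral.integral_sub (hδ.intervalIntegrable_mul_deriv.const_mul _)
      (hδ.intervalIntegrable_sq_div.const_mul _),
    intervalIntegral.integral_const_mul, intervalIntegral.integral_const_mul,
    hδ.integral_mul_deriv] at hle
  linarith

end IsLSL

/-- For every lower semilinear diagonal, `2 τ(δ)² / (1 + τ(δ)) ≤ ξ(δ)`. -/
theorem xi_lower_bound (δ : ℝ → ℝ) (hδ : IsLSL δ) :
    2 * (tauLSL δ) ^ 2 / (1 + tauLSL δ) ≤ xiLSL δ := by
  have hpos := hδ.integral_sq_div_pos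
  have hcs := hδ.sub_le_integral_mul_deriv_sq (1 / (2 * ∫ t in (0 : ℝ)..1, δ t ^ 2 / t))
  rw [hδ.xiLSL_eq, tauLSL]
  set A := ∫ t in (0 : ℝ)..1, δ t ^ 2 / t
  have hA : 1 / (2 * A) - (1 / (2 * A)) ^ 2 * A = 1 / (4 * A) := by
    field_simp
    norm_num
  have hτ : 2 * (4 * A - 1) ^ 2 / (1 + (4 * A - 1)) = 8 * A - 4 + 2 * (1 / (4 * A)) := by
    rw [add_sub_cancel]
    field_simp
    ring
  linarith
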